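/- Let m be a positive integer, q ∈ (1, m+1], and c, c', d ∈ A'_q. If c' > c in the lexicographic order, then f_{c',d}(p) > f_{c,d}(p) for all p ≥ q with p ≤ m+1. Similarly, if d' ∈ A'_q with d' > d lexicographically, then f_{c,d'}(p) > f_{c,d}(p) for all such p. -/

import Mathlib

/-- A sequence of digits has a last nonzero digit. -/
def hasLastNonzero (c : ℕ → ℕ) : Prop := ∃ n, c n ≠ 0 ∧ ∀ i > n, c i = 0

/-- `c` (with `c i` the `(i+1)`-st digit) is a `q`-expansion of `x`
with respect to the digit set `Ω_m = {0,1,…,m}`. -/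
def isExpansion (m : ℕ) (q : ℝ) (x : ℝ) (c : ℕ → ℕ) : Prop :=
  (∀ i, c i ≤ m) ∧ x = ∑' i : ℕ, (c i : ℝ) / q ^ (i + 1)

/-- The set `U_q` of points of `I_q = [0, m/(q-1)]` with a unique `q`-expansion. -/
def Uq (m : ℕ) (q : ℝ) : Set ℝ :=
  {x | x ∈ Set.Icc 0 ((m : ℝ) / (q - 1)) ∧ ∃! c, isExpansion m q x c}

/-- The set `U'_q` of digit sequences that are unique `q`-expansions. -/
def Uq' (m : ℕ) (q : ℝ) : Set (ℕ → ℕ) :=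
  {c | isExpansion m q (∑' i : ℕ, (c i : ℝ) / q ^ (i + 1)) c ∧
       ∀ d, isExpansion m q (∑' i : ℕ, (c i : ℝ) / q ^ (i + 1)) d → d = c}

/-- `B_2(m)`: bases `q ∈ (1, m+1]` for which some `x ∈ I_q` has exactly two
different `q`-expansions. -/
def B2 (m : ℕ) : Set ℝ :=
  {q | q ∈ Set.Ioc 1 ((m : ℝ) + 1) ∧
    ∃ x ∈ Set.Icc (0 : ℝ) ((m : ℝ) / (q - 1)), ∃ a b : ℕ → ℕ,
      a ≠ b ∧ isExpansion m q x a ∧ isExpansion m q x b ∧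
      ∀ c, isExpansion m q x c → c = a ∨ c = b}

/-- Strict lexicographic order on digit sequences. -/
def lexLt (a b : ℕ → ℕ) : Prop := ∃ n, (∀ i < n, a i = b i) ∧ a n < b n

/-- Lexicographic order on digit sequences. -/
def lexLe (a b : ℕ → ℕ) : Prop := lexLt a b ∨ a = b

/-- `a` is the quasi-greedy `q`-expansion of `1`: the lexicographically largest
`q`-expansion of `1` without a last nonzero digit. -/
def isQuasiGreedy (m : ℕ) (q : ℝ) (a : ℕ → ℕ) : Prop :=
  isExpansion m q 1 a ∧ ¬ hasLastNonzero a ∧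
  ∀ b, isExpansion m q 1 b → ¬ hasLastNonzero b → lexLe b a

/-- `A'_q = {(c_i) ∈ U'_q : c_1 < α_1(q)}`. -/
def Aq' (m : ℕ) (q : ℝ) : Set (ℕ → ℕ) :=
  {c | c ∈ Uq' m q ∧ ∀ a, isQuasiGreedy m q a → c 0 < a 0}

/-- `f_{c,d}(t) = (m+1)/t + Σ_{i≥1} (c_i + d_i) t^{-(i+1)} - m/(t-1)`. -/
noncomputable def fcd (m : ℕ) (c d : ℕ → ℕ) (t : ℝ) : ℝ :=
  ((m : ℝ) + 1) / t + (∑' i : ℕ, ((c i : ℝ) + (d i : ℝ)) / t ^ (i + 2)) - (m : ℝ) / (t - 1)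

/-- `x = q_f(m)`: the largest real root of `q³-(k+2)q²+q-(k+1)=0` if `m = 2k+1`,
and of `q²-(k+1)q-k=0` if `m = 2k`. -/
def isQf (m : ℕ) (x : ℝ) : Prop :=
  (∃ k : ℕ, m = 2 * k + 1 ∧
    x ^ 3 - ((k : ℝ) + 2) * x ^ 2 + x - ((k : ℝ) + 1) = 0 ∧
    ∀ y : ℝ, y ^ 3 - ((k : ℝ) + 2) * y ^ 2 + y - ((k : ℝ) + 1) = 0 → y ≤ x) ∨
  (∃ k : ℕ, m = 2 * k ∧
    x ^ 2 - ((k : ℝ) + 1) * x - (k : ℝ) = 0 ∧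
    ∀ y : ℝ, y ^ 2 - ((k : ℝ) + 1) * y - (k : ℝ) = 0 → y ≤ x)

/-- A doubly infinite sequence: neither it nor its reflection has a last nonzero digit. -/
def doublyInfinite (m : ℕ) (c : ℕ → ℕ) : Prop :=
  ¬ hasLastNonzero c ∧ ¬ hasLastNonzero (fun i => m - c i)

/-- `V_q`: points of `I_q` with at most one doubly infinite `q`-expansion. -/
def Vq (m : ℕ) (q : ℝ) : Set ℝ :=
  {x | x ∈ Set.Icc 0 ((m : ℝ) / (q - 1)) ∧
    ∀ a b : ℕ → ℕ, isExpansion m q x a → isExpansion m q x b →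
      doublyInfinite m a → doublyInfinite m b → a = b}

/-- `U = {q ∈ (1, m+1] : 1 ∈ U_q}`. -/
def Uset (m : ℕ) : Set ℝ := {q | q ∈ Set.Ioc 1 ((m : ℝ) + 1) ∧ (1 : ℝ) ∈ Uq m q}

/-- `V = {q ∈ (1, m+1] : 1 ∈ V_q}`. -/
def Vset (m : ℕ) : Set ℝ := {q | q ∈ Set.Ioc 1 ((m : ℝ) + 1) ∧ (1 : ℝ) ∈ Vq m q}

/-- The generalized golden ratio `G(m)`. -/
noncomputable def Gratio (m : ℕ) : ℝ :=
  if m % 2 = 0 then ((m / 2 : ℕ) : ℝ) + 1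
  else (((m / 2 : ℕ) : ℝ) + 1 +
    Real.sqrt (((m / 2 : ℕ) : ℝ) ^ 2 + 6 * ((m / 2 : ℕ) : ℝ) + 5)) / 2

/-- The set of accumulation points of a set of reals. -/
def accPts (S : Set ℝ) : Set ℝ := {x | AccPt x (Filter.principal S)}

/-- Iterated accumulation-point sets `B_2^{(i)}(m)`. -/
def B2iter (m : ℕ) : ℕ → Set ℝ
  | 0 => B2 m
  | n + 1 => accPts (B2iter m n)

/-- The value of a digit sequence in base `q`. -/
noncomputable def digitValue (q : ℝ) (c : ℕ → ℕ) : ℝ := ∑' i : ℕ, (c i : ℝ) / q ^ (i + 1)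

theorem hasSum_const_div_pow {q : ℝ} (hq : 1 < q) (m : ℝ) :
    HasSum (fun i : ℕ => m / q ^ (i + 1)) (m / (q - 1)) := by
  have hq0 : 0 < q := by linarith
  have h := (hasSum_geometric_of_lt_one (inv_nonneg.2 hq0.le) (inv_lt_one_of_one_lt₀ hq)).mul_left
    (m / q)
  have h1 : q - 1 ≠ 0 := by linarith
  have hval : m / q * (1 - q⁻¹)⁻¹ = m / (q - 1) := by
    have h2 : 1 - q⁻¹ = (q - 1) / q := by field_simp
    rw [h2]
    field_simp
  have hterm : (fun i : ℕ => m / q * q⁻¹ ^ i) = fun i : ℕ => m / q ^ (i + 1) := by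
    funext i
    rw [inv_pow]
    field_simp
    ring
  rwa [hval, hterm] at h

theorem summable_digits {m : ℕ} {q : ℝ} (hq : 1 < q) {c : ℕ → ℕ} (hc : ∀ i, c i ≤ m) :
    Summable (fun i : ℕ => (c i : ℝ) / q ^ (i + 1)) := by
  have hq0 : 0 < q := by linarith
  refine Summable.of_nonneg_of_le (fun i => by positivity) (fun i => ?_)
    (hasSum_const_div_pow hq m).summable
  have : (c i : ℝ) ≤ m := by exact_mod_cast hc i
  gcongr

theorem digitValue_nonneg {q : ℝ} (hq : 0 < q) (c : ℕ → ℕ) : 0 ≤ digitValue q c :=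
  tsum_nonneg fun _ => by positivity

theorem digitValue_le {m : ℕ} {q : ℝ} (hq : 1 < q) {c : ℕ → ℕ} (hc : ∀ i, c i ≤ m) :
    digitValue q c ≤ m / (q - 1) := by
  have hq0 : 0 < q := by linarith
  rw [← (hasSum_const_div_pow hq (m : ℝ)).tsum_eq]
  refine (summable_digits hq hc).tsum_le_tsum (fun i => ?_) (hasSum_const_div_pow hq m).summable
  have : (c i : ℝ) ≤ m := by exact_mod_cast hc i
  gcongr

theorem digitValue_antitone {m : ℕ} {p q : ℝ} (hq : 1 < q) (hqp : q ≤ p) {c : ℕ → ℕ}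
    (hc : ∀ i, c i ≤ m) : digitValue p c ≤ digitValue q c := by
  have hq0 : 0 < q := by linarith
  refine (summable_digits (hq.trans_le hqp) hc).tsum_le_tsum (fun i => ?_) (summable_digits hq hc)
  gcongr

theorem digitValue_eq_sum_add {m : ℕ} {q : ℝ} (hq : 1 < q) {c : ℕ → ℕ} (hc : ∀ i, c i ≤ m)
    (n : ℕ) :
    digitValue q c = ∑ i ∈ Finset.range n, (c i : ℝ) / q ^ (i + 1)
      + digitValue q (fun i => c (i + n)) / q ^ n := by
  have hq0 : 0 < q := by linarith
  rw [digitValue, digitValue, ← (summable_digits hq hc).sum_add_tsum_nat_add n, ← tsum_div_const]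
  congr 2
  funext i
  rw [div_div, ← pow_add]
  congr 2
  ring

theorem digitValue_eq_sum_add_digit {m : ℕ} {q : ℝ} (hq : 1 < q) {c : ℕ → ℕ}
    (hc : ∀ i, c i ≤ m) (n : ℕ) :
    digitValue q c = ∑ i ∈ Finset.range n, (c i : ℝ) / q ^ (i + 1)
      + (c n + digitValue q (fun i => c (i + (n + 1)))) / q ^ (n + 1) := by
  rw [digitValue_eq_sum_add hq hc (n + 1), Finset.sum_range_succ]
  ring

/-- The orbit of `y` under the greedy map `x ↦ q x - min m ⌊q x⌋`. -/
noncomputable def greedyOrbit (m : ℕ) (q y : ℝ) : ℕ → ℝ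
  | 0 => y
  | k + 1 => q * greedyOrbit m q y k - (min m ⌊q * greedyOrbit m q y k⌋₊ : ℕ)

theorem greedyOrbit_mem {m : ℕ} {q y : ℝ} (hq : 1 < q) (hqm : q ≤ m + 1)
    (hy : y ∈ Set.Icc 0 ((m : ℝ) / (q - 1))) (k : ℕ) :
    greedyOrbit m q y k ∈ Set.Icc 0 ((m : ℝ) / (q - 1)) := by
  have hq1 : 0 < q - 1 := by linarith
  induction k with
  | zero => exact hy
  | succ k ih =>
    obtain ⟨h0, h1⟩ := ih
    have hnn : 0 ≤ q * greedyOrbit m q y k := by positivity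
    rw [greedyOrbit]
    rcases le_total m ⌊q * greedyOrbit m q y k⌋₊ with h | h
    · rw [min_eq_left h]
      refine ⟨sub_nonneg.2 ((Nat.le_floor_iff hnn).1 h), ?_⟩
      rw [le_div_iff₀ hq1] at h1 ⊢
      nlinarith
    · rw [min_eq_right h]
      refine ⟨sub_nonneg.2 (Nat.floor_le hnn), ?_⟩
      have h2 := Nat.lt_floor_add_one (q * greedyOrbit m q y k)
      have h3 : 1 ≤ (m : ℝ) / (q - 1) := by
        rw [le_div_iff₀ hq1]
        linarith
      linarith

theorem exists_digitValue_eq {m : ℕ} {q y : ℝ} (hq : 1 < q) (hqm : q ≤ m + 1)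
    (hy : y ∈ Set.Icc 0 ((m : ℝ) / (q - 1))) :
    ∃ g : ℕ → ℕ, (∀ i, g i ≤ m) ∧ digitValue q g = y := by
  have hq0 : 0 < q := by linarith
  let g : ℕ → ℕ := fun k => min m ⌊q * greedyOrbit m q y k⌋₊
  have hg : ∀ i, g i ≤ m := fun i => min_le_left _ _
  refine ⟨g, hg, ?_⟩
  have hsum : ∀ n, ∑ i ∈ Finset.range n, (g i : ℝ) / q ^ (i + 1)
      = y - greedyOrbit m q y n / q ^ n := by
    intro n
    induction n with
    | zero => simp [greedyOrbit]
    | succ n ih =>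
      have : greedyOrbit m q y (n + 1) = q * greedyOrbit m q y n - g n := rfl
      rw [Finset.sum_range_succ, ih, this]
      field_simp
      ring
  have hrem : Filter.Tendsto (fun n => greedyOrbit m q y n / q ^ n) Filter.atTop (nhds 0) := by
    have hlim : Filter.Tendsto (fun n : ℕ => (m : ℝ) / (q - 1) / q ^ n) Filter.atTop (nhds 0) :=
      (tendsto_pow_atTop_atTop_of_one_lt hq).const_div_atTop _
    refine squeeze_zero (fun n => ?_) (fun n => ?_) hlim
    · exact div_nonneg (greedyOrbit_mem hq hqm hy n).1 (by positivity)
    · have := (greedyOrbit_mem hq hqm hy n).2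
      gcongr
  have hlim := (summable_digits hq hg).hasSum.tendsto_sum_nat
  simp only [hsum] at hlim
  refine tendsto_nhds_unique hlim ?_
  simpa using tendsto_const_nhds.sub hrem

/-- In a unique expansion, the tail after a digit smaller than `m` has value smaller than `1`. -/
theorem digitValue_tail_lt_one {m : ℕ} {q : ℝ} (hq : 1 < q) (hqm : q ≤ m + 1) {c : ℕ → ℕ}
    (hc : c ∈ Uq' m q) {n : ℕ} (hn : c n < m) :
    digitValue q (fun i => c (i + (n + 1))) < 1 := by
  obtain ⟨⟨hcm, -⟩, huniq⟩ := hc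
  by_contra! htail
  obtain ⟨g, hg, hgval⟩ := exists_digitValue_eq hq hqm
    (y := digitValue q (fun i => c (i + (n + 1))) - 1)
    ⟨by linarith, by linarith [digitValue_le hq fun i => hcm (i + (n + 1))]⟩
  let e : ℕ → ℕ := fun i => if i < n then c i else if i = n then c n + 1 else g (i - (n + 1))
  have he : ∀ i, e i ≤ m := by
    intro i
    simp only [e]
    split_ifs
    exacts [hcm i, hn, hg _]
  have hen : e n = c n + 1 := by simp [e]
  have hetail : (fun i => e (i + (n + 1))) = g := by
    funext i
    have h1 : ¬ i + (n + 1) < n := by omega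
    have h2 : i + (n + 1) ≠ n := by omega
    simp [e, h1, h2]
  have hehead : ∑ i ∈ Finset.range n, (e i : ℝ) / q ^ (i + 1)
      = ∑ i ∈ Finset.range n, (c i : ℝ) / q ^ (i + 1) := by
    refine Finset.sum_congr rfl fun i hi => ?_
    simp [e, Finset.mem_range.1 hi]
  have hval : digitValue q c = digitValue q e := by
    rw [digitValue_eq_sum_add_digit hq hcm n, digitValue_eq_sum_add_digit hq he n, hehead, hetail,
      hen, hgval]
    push_cast
    ring
  have := congrFun (huniq e ⟨he, hval⟩) n
  omega

theorem digitValue_lt_of_lexLt {m : ℕ} {p q : ℝ} (hq : 1 < q) (hqm : q ≤ m + 1) (hqp : q ≤ p)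
    {c c' : ℕ → ℕ} (hc : c ∈ Uq' m q) (hc' : ∀ i, c' i ≤ m) (h : lexLt c c') :
    digitValue p c < digitValue p c' := by
  obtain ⟨n, heq, hlt⟩ := h
  have hp : 1 < p := hq.trans_le hqp
  have hp0 : 0 < p := by linarith
  have htail := (digitValue_antitone hq hqp fun i => hc.1.1 (i + (n + 1))).trans_lt
    (digitValue_tail_lt_one hq hqm hc (hlt.trans_le (hc' n)))
  have htail' := digitValue_nonneg hp0 fun i => c' (i + (n + 1))
  have hhead : ∑ i ∈ Finset.range n, (c i : ℝ) / p ^ (i + 1)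
      = ∑ i ∈ Finset.range n, (c' i : ℝ) / p ^ (i + 1) :=
    Finset.sum_congr rfl fun i hi => by rw [heq i (Finset.mem_range.1 hi)]
  have hdigit : (c n : ℝ) + 1 ≤ c' n := by exact_mod_cast hlt
  rw [digitValue_eq_sum_add_digit hp hc.1.1 n, digitValue_eq_sum_add_digit hp hc' n, hhead]
  gcongr ?_ + ?_ / _
  linarith

theorem fcd_eq_digitValue {m : ℕ} {t : ℝ} (ht : 1 < t) {c d : ℕ → ℕ} (hc : ∀ i, c i ≤ m)
    (hd : ∀ i, d i ≤ m) :
    fcd m c d t = ((m : ℝ) + 1) / t + (digitValue t c + digitValue t d) / t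
      - (m : ℝ) / (t - 1) := by
  have ht0 : 0 < t := by linarith
  rw [fcd, digitValue, digitValue, ← (summable_digits ht hc).tsum_add (summable_digits ht hd),
    ← tsum_div_const]
  congr 3
  funext i
  rw [← add_div, div_div, ← pow_succ]

/-- `f_{c,d}` is strictly increasing in each of `c` and `d`
with respect to the lexicographic order, at every point `p ∈ [q, m+1]`. -/
theorem stmt6 (m : ℕ) (hm : 0 < m) (q : ℝ) (hq : q ∈ Set.Ioc 1 ((m : ℝ) + 1))
    (c c' d d' : ℕ → ℕ) (hc : c ∈ Aq' m q) (hc' : c' ∈ Aq' m q)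
    (hd : d ∈ Aq' m q) (hd' : d' ∈ Aq' m q) :
    (lexLt c c' → ∀ p, q ≤ p → p ≤ (m : ℝ) + 1 → fcd m c d p < fcd m c' d p) ∧
    (lexLt d d' → ∀ p, q ≤ p → p ≤ (m : ℝ) + 1 → fcd m c d p < fcd m c d' p) := by
  obtain ⟨hq1, hqm⟩ := hq
  constructor
  · intro h p hqp _
    have hp : 1 < p := hq1.trans_le hqp
    have hlt := digitValue_lt_of_lexLt hq1 hqm hqp hc.1 hc'.1.1.1 h
    rw [fcd_eq_digitValue hp hc.1.1.1 hd.1.1.1, fcd_eq_digitValue hp hc'.1.1.1 hd.1.1.1]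
    gcongr
  · intro h p hqp _
    have hp : 1 < p := hq1.trans_le hqp
    have hlt := digitValue_lt_of_lexLt hq1 hqm hqp hd.1 hd'.1.1.1 h
    rw [fcd_eq_digitValue hp hc.1.1.1 hd.1.1.1, fcd_eq_digitValue hp hc.1.1.1 hd'.1.1.1]
    gcongr
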